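/- For $\mathrm{Re}\,\beta > -1$ (with $\kappa = \beta/2$) and any integer $k$, $\int_0^{2\pi} \frac{d\theta}{2\pi} e^{ik\theta}\left(\sin\tfrac{\theta}{2}\right)^{\beta} = (-1)^k 2^{-\beta} \frac{\Gamma(1+2\kappa)}{\Gamma(1+\kappa+k)\,\Gamma(1+\kappa-k)}$. -/

import Mathlib

open Real Complex in
/-- The integrand obtained from the symmetric Beta integral by the substitution
`x = (1 - cos (θ / 2)) / 2`. -/
lemma beta_integrand_comp_one_sub_cos_half (β : ℂ) {θ : ℝ} (hθ : θ ∈ Set.Ioo 0 (2 * π)) :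
    (Real.sin (θ / 2) / 4) • ((((1 - Real.cos (θ / 2)) / 2 : ℝ) : ℂ) ^ ((β + 1) / 2 - 1) *
      (1 - (((1 - Real.cos (θ / 2)) / 2 : ℝ) : ℂ)) ^ ((β + 1) / 2 - 1)) =
    (2⁻¹ * (2 : ℂ) ^ (-β)) * (Real.sin (θ / 2) : ℂ) ^ β := by
  have hs : 0 < Real.sin (θ / 2) :=
    Real.sin_pos_of_pos_of_lt_pi (by linarith [hθ.1]) (by linarith [hθ.2])
  have h1 : (1 - (((1 - Real.cos (θ / 2)) / 2 : ℝ) : ℂ)) =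
      (((1 + Real.cos (θ / 2)) / 2 : ℝ) : ℂ) := by push_cast; ring
  have h2 : (((1 - Real.cos (θ / 2)) / 2 : ℝ) : ℂ) * (((1 + Real.cos (θ / 2)) / 2 : ℝ) : ℂ) =
      ((Real.sin (θ / 2) / 2 : ℝ) : ℂ) * ((Real.sin (θ / 2) / 2 : ℝ) : ℂ) := by
    rw [← ofReal_mul, ← ofReal_mul]
    congr 1
    linear_combination (1 / 4 : ℝ) * Real.sin_sq_add_cos_sq (θ / 2) * (-1)
  have hs2 : ((Real.sin (θ / 2) / 2 : ℝ) : ℂ) ≠ 0 := by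
    exact_mod_cast (half_pos hs).ne'
  have h3 : (Real.sin (θ / 2) : ℂ) = ((2 : ℝ) : ℂ) * ((Real.sin (θ / 2) / 2 : ℝ) : ℂ) := by
    push_cast; ring
  rw [h1, ← mul_cpow_ofReal_nonneg (by linarith [Real.cos_le_one (θ / 2)])
    (by linarith [Real.neg_one_le_cos (θ / 2)]), h2,
    mul_cpow_ofReal_nonneg (half_pos hs).le (half_pos hs).le, ← cpow_add _ _ hs2,
    show (β + 1) / 2 - 1 + ((β + 1) / 2 - 1) = β - 1 by ring, cpow_sub _ _ hs2, cpow_one, h3,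
    mul_cpow_ofReal_nonneg zero_le_two (half_pos hs).le, cpow_neg, real_smul]
  have h4 : (2 : ℂ) ^ β ≠ 0 := by simp [cpow_eq_zero_iff]
  have h5 : Complex.sin (θ / 2) ≠ 0 := by exact_mod_cast hs.ne'
  push_cast
  field_simp
  norm_num

open Real Complex in
/-- Integrability and value of `(sin (θ / 2)) ^ β`, through the symmetric Beta integral. -/
lemma sin_half_cpow_integrable_and_integral (β : ℂ) (hβ : -1 < β.re) :
    IntervalIntegrable (fun θ : ℝ => (Real.sin (θ / 2) : ℂ) ^ β) MeasureTheory.volume 0 (2 * π) ∧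
    (2⁻¹ * (2 : ℂ) ^ (-β)) * ∫ θ in (0 : ℝ)..(2 * π), (Real.sin (θ / 2) : ℂ) ^ β =
      betaIntegral ((β + 1) / 2) ((β + 1) / 2) := by
  have hu : 0 < ((β + 1) / 2).re := by
    rw [div_ofNat_re, add_re, one_re]; linarith
  have hpi : (0 : ℝ) ≤ 2 * π := by positivity
  let f : ℝ → ℝ := fun θ => (1 - Real.cos (θ / 2)) / 2
  let g : ℝ → ℂ := fun x => (x : ℂ) ^ ((β + 1) / 2 - 1) * (1 - (x : ℂ)) ^ ((β + 1) / 2 - 1)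
  have hf : ContinuousOn f (Set.uIcc 0 (2 * π)) := by fun_prop
  have hff' : ∀ θ ∈ Set.Ioo (min 0 (2 * π)) (max 0 (2 * π)),
      HasDerivAt f (Real.sin (θ / 2) / 4) θ := by
    intro θ _
    convert! ((((hasDerivAt_id θ).div_const 2).cos).const_sub 1).div_const 2 using 1
    simp; ring
  have hf' : ∀ θ ∈ Set.Ioo (min 0 (2 * π)) (max 0 (2 * π)), 0 ≤ Real.sin (θ / 2) / 4 := by
    intro θ hθ
    rw [min_eq_left hpi, max_eq_right hpi] at hθ
    exact div_nonneg (Real.sin_nonneg_of_nonneg_of_le_pi (by linarith [hθ.1])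
      (by linarith [hθ.2])) (by norm_num)
  have hf0 : f 0 = 0 := by simp [f]
  have hf1 : f (2 * π) = 1 := by
    simp only [f]; rw [mul_div_cancel_left₀ _ two_ne_zero, Real.cos_pi]; norm_num
  have hcongr : Set.EqOn (fun θ => (Real.sin (θ / 2) / 4) • (g ∘ f) θ)
      (fun θ => (2⁻¹ * (2 : ℂ) ^ (-β)) * (Real.sin (θ / 2) : ℂ) ^ β)
      (Set.uIoo 0 (2 * π)) := by
    intro θ hθ
    rw [Set.uIoo_of_le hpi] at hθ
    exact beta_integrand_comp_one_sub_cos_half β hθ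
  have hc : 2⁻¹ * (2 : ℂ) ^ (-β) ≠ 0 := by simp [cpow_eq_zero_iff]
  constructor
  · have h := (intervalIntegral.integrable_deriv_smul_comp_iff_of_deriv_nonneg
      (g := g) hf hff' hf').2 (by rw [hf0, hf1]; exact betaIntegral_convergent hu hu)
    have h2 := (h.congr_uIoo hcongr).const_mul (2⁻¹ * (2 : ℂ) ^ (-β))⁻¹
    simpa only [inv_mul_cancel_left₀ hc] using h2
  · rw [← intervalIntegral.integral_const_mul, ← intervalIntegral.integral_congr_uIoo hcongr,
      intervalIntegral.integral_deriv_smul_comp_of_deriv_nonneg hf hff' hf', hf0, hf1]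
    rfl

open Real Complex in
/-- The zeroth moment. -/
lemma integral_sin_half_cpow (β : ℂ) (hβ : -1 < β.re) :
    ∫ θ in (0 : ℝ)..(2 * π), (Real.sin (θ / 2) : ℂ) ^ β =
      2 * π * ((2 : ℂ) ^ (-β) * Complex.Gamma (1 + β) /
        (Complex.Gamma (1 + β / 2) * Complex.Gamma (1 + β / 2))) := by
  have hu : 0 < ((β + 1) / 2).re := by
    rw [div_ofNat_re, add_re, one_re]; linarith
  have h := (sin_half_cpow_integrable_and_integral β hβ).2
  rw [betaIntegral_eq_Gamma_mul_div _ _ hu hu, add_halves] at h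
  have hd := Complex.Gamma_mul_Gamma_add_half ((β + 1) / 2)
  rw [show (β + 1) / 2 + 1 / 2 = 1 + β / 2 by ring, show 2 * ((β + 1) / 2) = β + 1 by ring,
    show 1 - (β + 1) = -β by ring] at hd
  have hG : Complex.Gamma (1 + β / 2) ≠ 0 := by
    apply Gamma_ne_zero_of_re_pos
    rw [add_re, one_re, div_ofNat_re]; linarith
  have hG1 : Complex.Gamma (β + 1) ≠ 0 := by
    apply Gamma_ne_zero_of_re_pos
    rw [add_re, one_re]; linarith
  have hc : (2 : ℂ) ^ (-β) ≠ 0 := by simp [cpow_eq_zero_iff]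
  have hpi : ((√π : ℝ) : ℂ) ^ 2 = π := by
    rw [← ofReal_pow, Real.sq_sqrt pi_pos.le]
  rw [add_comm 1 β]
  rw [eq_div_iff hG1] at h
  rw [← mul_div_assoc, eq_div_iff (mul_ne_zero hG hG)]
  apply mul_left_cancel₀ (mul_ne_zero (mul_ne_zero (inv_ne_zero two_ne_zero) hc) hG1)
  rw [← hpi]
  linear_combination Complex.Gamma (1 + β / 2) ^ 2 * h +
    (Complex.Gamma ((β + 1) / 2) * Complex.Gamma (1 + β / 2) +
      Complex.Gamma (β + 1) * 2 ^ (-β) * ((√π : ℝ) : ℂ)) * hd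

open Real Complex in
/-- The derivative of `e^{i(k+1/2)θ} (sin (θ/2))^{β+1}`. -/
lemma hasDerivAt_exp_mul_sin_half_cpow (β : ℂ) (k : ℤ) {θ : ℝ} (hθ : θ ∈ Set.Ioo 0 (2 * π)) :
    HasDerivAt (fun t : ℝ => Complex.exp (Complex.I * (k + 1 / 2) * t) *
        (Real.sin (t / 2) : ℂ) ^ (β + 1))
      ((1 + β / 2 + k) / 2 *
          (Complex.exp (Complex.I * (k + 1 : ℤ) * θ) * (Real.sin (θ / 2) : ℂ) ^ β) +
        (β / 2 - k) / 2 * (Complex.exp (Complex.I * k * θ) * (Real.sin (θ / 2) : ℂ) ^ β)) θ := by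
  have hs : 0 < Real.sin (θ / 2) :=
    Real.sin_pos_of_pos_of_lt_pi (by linarith [hθ.1]) (by linarith [hθ.2])
  have hs0 : (Real.sin (θ / 2) : ℂ) ≠ 0 := by exact_mod_cast hs.ne'
  have h1 : HasDerivAt (fun t : ℝ => Complex.exp (Complex.I * (k + 1 / 2) * t))
      (Complex.exp (Complex.I * (k + 1 / 2) * θ) * (Complex.I * (k + 1 / 2))) θ := by
    have := ((hasDerivAt_id θ).ofReal_comp.const_mul (Complex.I * (k + 1 / 2))).cexp
    simpa using this
  have h2 : HasDerivAt (fun t : ℝ => (Real.sin (t / 2) : ℂ) ^ (β + 1))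
      ((β + 1) * (Real.sin (θ / 2) : ℂ) ^ (β + 1 - 1) * (Real.cos (θ / 2) * (1 / 2))) θ := by
    have h := ((((hasDerivAt_id (θ : ℂ)).div_const 2).csin).cpow_const (c := β + 1) (by
      simpa using ofReal_mem_slitPlane.2 hs)).comp_ofReal
    simpa using h
  convert! h1.mul h2 using 1
  rw [add_sub_cancel_right, cpow_add _ _ hs0, cpow_one]
  have e1 : Complex.exp (Complex.I * (k + 1 : ℤ) * θ) =
      Complex.exp (Complex.I * (k + 1 / 2) * θ) * Complex.exp (θ / 2 * Complex.I) := by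
    rw [← Complex.exp_add]; congr 1; push_cast; ring
  have e2 : Complex.exp (Complex.I * k * θ) =
      Complex.exp (Complex.I * (k + 1 / 2) * θ) * Complex.exp (-(θ / 2) * Complex.I) := by
    rw [← Complex.exp_add]; congr 1; ring
  rw [e1, e2, Complex.exp_mul_I, Complex.exp_mul_I, Complex.cos_neg, Complex.sin_neg]
  push_cast
  ring

open Real Complex in
/-- Two-term recurrence for the moments, from integrating a total derivative. -/
lemma sine_power_moment_recurrence (β : ℂ) (hβ : -1 < β.re) (k : ℤ) :
    (1 + β / 2 + k) * (∫ θ in (0 : ℝ)..(2 * π),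
        Complex.exp (Complex.I * (k + 1 : ℤ) * θ) * (Real.sin (θ / 2) : ℂ) ^ β) =
      -((β / 2 - k) * ∫ θ in (0 : ℝ)..(2 * π),
        Complex.exp (Complex.I * k * θ) * (Real.sin (θ / 2) : ℂ) ^ β) := by
  have hint (m : ℤ) : IntervalIntegrable (fun θ : ℝ => Complex.exp (Complex.I * m * θ) *
      (Real.sin (θ / 2) : ℂ) ^ β) MeasureTheory.volume 0 (2 * π) :=
    (sin_half_cpow_integrable_and_integral β hβ).1.continuousOn_mul (by fun_prop)
  have hre : 0 < (β + 1).re := by rw [add_re, one_re]; linarith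
  have hne : β + 1 ≠ 0 := by
    intro h; rw [h] at hre; simp at hre
  have hcont : ContinuousOn (fun t : ℝ => Complex.exp (Complex.I * (k + 1 / 2) * t) *
      (Real.sin (t / 2) : ℂ) ^ (β + 1)) (Set.Icc 0 (2 * π)) := by
    refine Continuous.continuousOn (Continuous.mul (by fun_prop) ?_)
    exact (continuous_ofReal_cpow_const hre).comp
      (Real.continuous_sin.comp (continuous_id.div_const 2))
  have h := intervalIntegral.integral_eq_sub_of_hasDerivAt_of_le (by positivity) hcont
    (fun θ hθ => hasDerivAt_exp_mul_sin_half_cpow β k hθ)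
    (((hint (k + 1)).const_mul _).add ((hint k).const_mul _))
  rw [intervalIntegral.integral_add ((hint (k + 1)).const_mul _) ((hint k).const_mul _),
    intervalIntegral.integral_const_mul, intervalIntegral.integral_const_mul,
    mul_div_cancel_left₀ _ (two_ne_zero' ℝ), Real.sin_pi, zero_div, Real.sin_zero, ofReal_zero,
    zero_cpow hne, mul_zero, mul_zero, sub_zero] at h
  linear_combination 2 * h

open Complex in
/-- The recurrence in `k` satisfied by `(-1)^k / (Γ(1+κ+k) Γ(1+κ-k))`. -/
lemma neg_one_zpow_div_Gamma_mul_Gamma_recurrence (κ : ℂ) (k : ℤ) :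
    (1 + κ + k) * ((-1) ^ (k + 1) / (Gamma (1 + κ + (k + 1 : ℤ)) * Gamma (1 + κ - (k + 1 : ℤ)))) =
      -((κ - k) * ((-1) ^ k / (Gamma (1 + κ + k) * Gamma (1 + κ - k)))) := by
  have h1 := one_div_Gamma_eq_self_mul_one_div_Gamma_add_one (1 + κ + k)
  have h2 := one_div_Gamma_eq_self_mul_one_div_Gamma_add_one (κ - k)
  rw [show 1 + κ + k + 1 = 1 + κ + (k + 1 : ℤ) by push_cast; ring] at h1
  rw [show κ - k + 1 = 1 + κ - k by ring,
    show κ - k = 1 + κ - (k + 1 : ℤ) by push_cast; ring] at h2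
  rw [div_eq_mul_inv, div_eq_mul_inv, mul_inv, mul_inv, h1, h2,
    zpow_add_one₀ (by norm_num : (-1 : ℂ) ≠ 0)]
  push_cast
  ring

open Real Complex in
/-- Fourier moments of powers of the sine: for `Re β > -1`, `κ = β/2` and `k ∈ ℤ`,
`∫₀^{2π} (dθ/2π) e^{ikθ} (sin(θ/2))^β
  = (-1)^k 2^{-β} Γ(1+2κ) / (Γ(1+κ+k) Γ(1+κ-k))`. -/
theorem sine_power_fourier_moment (β : ℂ) (hβ : -1 < β.re) (k : ℤ) :
    (1 / (2 * (π : ℂ))) * ∫ θ in (0 : ℝ)..(2 * π),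
        Complex.exp (Complex.I * k * θ) * ((Real.sin (θ / 2) : ℂ)) ^ β =
      (-1) ^ k * (2 : ℂ) ^ (-β) * Complex.Gamma (1 + β) /
        (Complex.Gamma (1 + β / 2 + k) * Complex.Gamma (1 + β / 2 - k)) := by
  have hpi : (π : ℂ) ≠ 0 := ofReal_ne_zero.2 pi_ne_zero
  let R : ℤ → ℂ := fun m => (-1) ^ m / (Complex.Gamma (1 + β / 2 + m) *
    Complex.Gamma (1 + β / 2 - m))
  have hR (m : ℤ) : (1 + β / 2 + m) * R (m + 1) = -((β / 2 - m) * R m) :=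
    neg_one_zpow_div_Gamma_mul_Gamma_recurrence (β / 2) m
  have hJ := sine_power_moment_recurrence β hβ
  suffices h : ∫ θ in (0 : ℝ)..(2 * π),
      Complex.exp (Complex.I * k * θ) * ((Real.sin (θ / 2) : ℂ)) ^ β =
        2 * π * ((2 : ℂ) ^ (-β) * Complex.Gamma (1 + β) * R k) by
    rw [h]
    simp only [R]
    field_simp
  induction k using Int.induction_on with
  | zero => simpa [R, div_eq_mul_inv] using integral_sin_half_cpow β hβ
  | succ n ih =>
    have hne : 1 + β / 2 + (n : ℤ) ≠ 0 := by
      intro h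
      have := congrArg re h
      simp only [add_re, one_re, div_ofNat_re, Int.cast_natCast, natCast_re, zero_re] at this
      linarith [(Nat.cast_nonneg n : (0 : ℝ) ≤ n)]
    apply mul_left_cancel₀ hne
    rw [hJ, ih]
    linear_combination (-2 * π * ((2 : ℂ) ^ (-β) * Complex.Gamma (1 + β))) * hR n
  | pred n ih =>
    have hne : β / 2 - (-(n : ℤ) - 1 : ℤ) ≠ 0 := by
      intro h
      have := congrArg re h
      push_cast at this
      simp only [sub_re, neg_re, one_re, div_ofNat_re, natCast_re, zero_re] at this
      linarith [(Nat.cast_nonneg n : (0 : ℝ) ≤ n)]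
    have hJn := hJ (-n - 1)
    have hRn := hR (-n - 1)
    rw [sub_add_cancel] at hJn hRn
    rw [ih] at hJn
    apply mul_left_cancel₀ hne
    linear_combination hJn - (2 * π * ((2 : ℂ) ^ (-β) * Complex.Gamma (1 + β))) * hRn
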